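/- arXiv:2402.10970 — 5 statements merged into one kernel-verified Lean document; each statement's English description precedes it below -/
import Mathlib

section
/- There exists a function h : (0,∞) → (0,∞) such that: (i) h is log convex on (0,∞) (i.e., log ∘ h is convex on (0,∞)); (ii) h is integrable on (0,∞); (iii) lim_{n→∞} h(n)^{1/n} = 1 (limit over positive integers n); and (iv) for every real number r > 0, the function x ↦ h(x)^r / h(r·x) is not integrable on (0,∞). -/
open MeasureTheory Set Filter Real

noncomputable def cc : ℕ → ℝ
  | 0 => 1
  | (k+1) => cc k + 1 + (((k:ℝ)+1)^2 * cc k + Real.exp (((k:ℝ)+1) * cc k))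

noncomputable def aa (k : ℕ) : ℝ := ((k:ℝ)+1)^2 * cc k

noncomputable def bb (k : ℕ) : ℝ := ((k:ℝ)+1)^2 * cc k + Real.exp (((k:ℝ)+1) * cc k)

lemma cc_succ (k : ℕ) : cc (k+1) = cc k + 1 + bb k := rfl

lemma cc_ge (k : ℕ) : 2 * (k:ℝ) + 1 ≤ cc k := by
  induction k with
  | zero => simp [cc]
  | succ k ih =>
    rw [cc_succ, bb]
    have hk : (0:ℝ) ≤ k := Nat.cast_nonneg k
    have h1 := Real.exp_pos (((k:ℝ)+1) * cc k)
    have h2 : (1:ℝ) * 1 ≤ ((k:ℝ)+1)^2 * cc k := by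
      apply mul_le_mul <;> nlinarith
    push_cast
    linarith

lemma bb_nonneg (k : ℕ) : 0 ≤ bb k := by
  have := cc_ge k
  have hk : (0:ℝ) ≤ k := Nat.cast_nonneg k
  have : 0 ≤ cc k := by linarith
  unfold bb; positivity

lemma cc_gap (k j : ℕ) : cc k + bb k + (j + 1 : ℝ) ≤ cc (k + 1 + j) := by
  induction j with
  | zero => rw [Nat.add_zero, cc_succ]; simp; linarith
  | succ j ih =>
    rw [← Nat.add_assoc, cc_succ]
    have := bb_nonneg (k+1+j)
    push_cast; linarith

noncomputable def TT (j : ℕ) (x : ℝ) : ℝ := Real.exp (-(x / ((j:ℝ)+1)) - cc j)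

noncomputable def hh (x : ℝ) : ℝ := ∑' j, TT j x

noncomputable def KK : ℝ := ∑' j : ℕ, Real.exp (-(j:ℝ))

lemma TT_pos (j : ℕ) (x : ℝ) : 0 < TT j x := Real.exp_pos _

lemma TT_le (j : ℕ) {x : ℝ} (hx : 0 ≤ x) : TT j x ≤ Real.exp (-(j:ℝ)) := by
  unfold TT
  have := cc_ge j
  have hk : (0:ℝ) ≤ j := Nat.cast_nonneg j
  have : 0 ≤ x / ((j:ℝ)+1) := by positivity
  apply Real.exp_le_exp.2; linarith

lemma TT_summable {x : ℝ} (hx : 0 ≤ x) : Summable (fun j => TT j x) :=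
  Real.summable_exp_neg_nat.of_nonneg_of_le (fun j => (TT_pos j x).le) (fun j => TT_le j hx)

lemma TT_le_hh (k : ℕ) {x : ℝ} (hx : 0 ≤ x) : TT k x ≤ hh x :=
  (TT_summable hx).le_tsum k (fun j _ => (TT_pos j x).le)

lemma hh_pos {x : ℝ} (hx : 0 ≤ x) : 0 < hh x := (TT_pos 0 x).trans_le (TT_le_hh 0 hx)

lemma hh_le {x : ℝ} (hx : 0 ≤ x) : hh x ≤ KK :=
  (TT_summable hx).tsum_le_tsum (fun j => TT_le j hx) Real.summable_exp_neg_nat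

lemma KK_pos : 0 < KK := (hh_pos le_rfl).trans_le (hh_le le_rfl)

lemma TT_dom (k j : ℕ) {y : ℝ} (h1 : aa k ≤ y) (h2 : y ≤ bb k) :
    TT j y ≤ Real.exp k * TT k y * Real.exp (-(j:ℝ)) := by
  unfold TT
  rw [← Real.exp_add, ← Real.exp_add]
  apply Real.exp_le_exp.2
  have hk : (0:ℝ) ≤ k := Nat.cast_nonneg k
  have hj : (0:ℝ) ≤ j := Nat.cast_nonneg j
  have hck := cc_ge k
  have hcj := cc_ge j
  have hy : 0 ≤ y := le_trans (by unfold aa; have : 0 ≤ cc k := by linarith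
                                  positivity) h1
  rcases lt_trichotomy j k with hlt | rfl | hgt
  · have hjk : (j:ℝ) + 1 ≤ k := by exact_mod_cast hlt
    have : cc k ≤ y / ((j:ℝ)+1) - y / ((k:ℝ)+1) := by
      have e : y / ((j:ℝ)+1) - y / ((k:ℝ)+1) = y * (k - j) / (((j:ℝ)+1) * (k+1)) := by
        field_simp; ring
      rw [e, le_div_iff₀ (by positivity)]
      have h3 : ((j:ℝ)+1) * (k+1) ≤ (k+1)^2 := by nlinarith
      calc cc k * (((j:ℝ)+1) * (k+1)) ≤ cc k * (k+1)^2 := by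
            apply mul_le_mul_of_nonneg_left h3; linarith
        _ = aa k := by unfold aa; ring
        _ ≤ y := h1
        _ ≤ y * (k - j) := by nlinarith
    linarith
  · linarith
  · obtain ⟨i, rfl⟩ := Nat.exists_eq_add_of_le (Nat.succ_le_of_lt hgt)
    have h3 := cc_gap k i
    have h4 : y / ((k:ℝ)+1) ≤ y := div_le_self hy (by linarith)
    have h5 : 0 ≤ y / (((k.succ + i : ℕ):ℝ)+1) := by positivity
    simp only [Nat.succ_eq_add_one] at *
    push_cast at *
    linarith

lemma hh_dom (k : ℕ) {y : ℝ} (h1 : aa k ≤ y) (h2 : y ≤ bb k) (hy : 0 ≤ y) :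
    hh y ≤ Real.exp k * TT k y * KK := by
  unfold KK
  rw [← tsum_mul_left]
  exact (TT_summable hy).tsum_le_tsum (fun j => TT_dom k j h1 h2)
    (Real.summable_exp_neg_nat.mul_left _)

lemma hh_convex : ConvexOn ℝ (Ioi (0 : ℝ)) (fun x => Real.log (hh x)) := by
  refine convexOn_iff_forall_pos.mpr ⟨convex_Ioi _, fun x hx y hy a b ha hb hab => ?_⟩
  simp only [smul_eq_mul]
  have hx' : 0 < x := hx
  have hy' : 0 < y := hy
  have hpx := hh_pos hx'.le
  have hpy := hh_pos hy'.le
  rw [← Real.log_rpow hpx, ← Real.log_rpow hpy,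
    ← Real.log_mul (Real.rpow_pos_of_pos hpx _).ne' (Real.rpow_pos_of_pos hpy _).ne']
  apply Real.log_le_log (hh_pos (by positivity))
  have ex : ∀ j, (TT j x ^ a) ^ (1/a) = TT j x := fun j => by
    rw [← Real.rpow_mul (TT_pos j x).le, mul_one_div_cancel ha.ne', Real.rpow_one]
  have ey : ∀ j, (TT j y ^ b) ^ (1/b) = TT j y := fun j => by
    rw [← Real.rpow_mul (TT_pos j y).le, mul_one_div_cancel hb.ne', Real.rpow_one]
  have exy : ∀ j, TT j x ^ a * TT j y ^ b = TT j (a * x + b * y) := fun j => by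
    unfold TT
    rw [← Real.exp_mul, ← Real.exp_mul, ← Real.exp_add]
    congr 1
    have : b = 1 - a := by linarith
    subst this
    ring
  have H := Real.inner_le_Lp_mul_Lq_tsum_of_nonneg
    (Real.holderConjugate_one_div ha hb hab)
    (f := fun j => TT j x ^ a) (g := fun j => TT j y ^ b)
    (fun j => (Real.rpow_pos_of_pos (TT_pos j x) _).le)
    (fun j => (Real.rpow_pos_of_pos (TT_pos j y) _).le)
    (by simpa only [ex] using TT_summable hx'.le) (by simpa only [ey] using TT_summable hy'.le)
  simp only [ex, ey, exy, one_div_one_div] at H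
  exact H

lemma TT_eq (j : ℕ) : TT j = fun x => Real.exp (-(1/((j:ℝ)+1)) * x) * Real.exp (- cc j) := by
  funext x
  unfold TT
  rw [← Real.exp_add]
  congr 1; ring

lemma TT_int (j : ℕ) : IntegrableOn (TT j) (Ioi 0) := by
  rw [TT_eq]
  exact (integrableOn_exp_mul_Ioi (neg_lt_zero.2 (by positivity)) 0).mul_const _

lemma TT_integral (j : ℕ) : ∫ x in Ioi 0, TT j x = ((j:ℝ)+1) * Real.exp (- cc j) := by
  rw [TT_eq, integral_mul_const, integral_exp_mul_Ioi (neg_lt_zero.2 (by positivity)) 0]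
  simp

lemma hh_int : IntegrableOn hh (Ioi 0) := by
  have hs : Summable (fun j : ℕ => ((j:ℝ)+1) * Real.exp (- cc j)) := by
    refine Real.summable_exp_neg_nat.of_nonneg_of_le (fun j => by positivity) (fun j => ?_)
    have h1 := cc_ge j
    calc ((j:ℝ)+1) * Real.exp (- cc j) ≤ Real.exp j * Real.exp (-cc j) := by
          gcongr; exact Real.add_one_le_exp _
      _ ≤ Real.exp (-(j:ℝ)) := by
          rw [← Real.exp_add]; apply Real.exp_le_exp.2; linarith
  have H := hasSum_integral_of_summable_integral_norm (μ := volume.restrict (Ioi 0)) (F := TT)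
    (fun j => TT_int j) (by
      simp only [Real.norm_of_nonneg (TT_pos _ _).le, TT_integral]
      exact hs)
  simp only [TT_integral] at H
  have hpos : 0 < ∫ x in Ioi 0, hh x := by
    have h0 := le_hasSum H 0 (fun j _ => by positivity)
    refine lt_of_lt_of_le ?_ h0
    positivity
  exact Integrable.of_integral_ne_zero hpos.ne'

lemma hh_lim : Tendsto (fun n : ℕ => hh n ^ ((n : ℝ)⁻¹)) atTop (nhds 1) := by
  have hinv : Tendsto (fun n : ℕ => ((n : ℝ)⁻¹)) atTop (nhds 0) :=
    tendsto_inv_atTop_nhds_zero_nat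
  rw [tendsto_order]
  constructor
  · intro l hl
    have hk : Tendsto (fun k : ℕ => Real.exp (-(1/((k:ℝ)+1)))) atTop (nhds 1) := by
      have := (Real.continuous_exp.tendsto _).comp
        (tendsto_one_div_add_atTop_nhds_zero_nat (𝕜 := ℝ)).neg
      simpa using! this
    obtain ⟨k, hk⟩ := (hk.eventually (lt_mem_nhds hl)).exists
    have hn : Tendsto (fun n : ℕ => Real.exp (-(1/((k:ℝ)+1)) - cc k * (n:ℝ)⁻¹)) atTop
        (nhds (Real.exp (-(1/((k:ℝ)+1)) - cc k * 0))) :=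
      (Real.continuous_exp.tendsto _).comp ((hinv.const_mul _).const_sub _)
    rw [mul_zero, sub_zero] at hn
    filter_upwards [hn.eventually (lt_mem_nhds hk), eventually_gt_atTop 0] with n h1 h2
    refine h1.trans_le ?_
    have hn0 : (0:ℝ) < n := by exact_mod_cast h2
    calc Real.exp (-(1/((k:ℝ)+1)) - cc k * (n:ℝ)⁻¹) = TT k n ^ ((n:ℝ)⁻¹) := by
          unfold TT
          rw [← Real.exp_mul]; congr 1; field_simp
      _ ≤ _ := Real.rpow_le_rpow (TT_pos _ _).le (TT_le_hh k hn0.le) (by positivity)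
  · intro u hu
    have hK : Tendsto (fun n : ℕ => KK ^ ((n:ℝ)⁻¹)) atTop (nhds 1) := by
      have := (Real.continuousAt_const_rpow (b := 0) KK_pos.ne').tendsto.comp hinv
      simpa using! this
    filter_upwards [hK.eventually (gt_mem_nhds hu)] with n h1
    refine lt_of_le_of_lt ?_ h1
    exact Real.rpow_le_rpow (hh_pos (Nat.cast_nonneg n)).le (hh_le (Nat.cast_nonneg n))
      (by positivity)

lemma hh_ratio (r : ℝ) (hr : 0 < r) (k : ℕ) {x : ℝ} (hx : 0 < x) (h1 : aa k ≤ r * x)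
    (h2 : r * x ≤ bb k) : Real.exp (-(r * cc k)) / KK ≤ hh x ^ r / hh (r * x) := by
  have hrx : 0 < r * x := by positivity
  have hK := KK_pos
  rw [div_le_div_iff₀ hK (hh_pos hrx.le)]
  have hck := cc_ge k
  have hk : (0:ℝ) ≤ k := Nat.cast_nonneg k
  calc Real.exp (-(r * cc k)) * hh (r * x)
      ≤ Real.exp (-(r * cc k)) * (Real.exp k * TT k (r * x) * KK) := by
        gcongr; exact hh_dom k h1 h2 hrx.le
    _ = Real.exp (-(r * cc k) + (k + (-((r * x) / ((k:ℝ)+1)) - cc k))) * KK := by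
        unfold TT; rw [Real.exp_add, Real.exp_add]; ring
    _ ≤ TT k x ^ r * KK := by
        unfold TT
        rw [← Real.exp_mul]
        gcongr
        have : (-(x / ((k:ℝ) + 1)) - cc k) * r = -(r * x / (k+1)) - r * cc k := by ring
        rw [this]; linarith
    _ ≤ hh x ^ r * KK := by
        gcongr
        · exact (TT_pos _ _).le
        · exact TT_le_hh k hx.le

lemma hh_nonint (r : ℝ) (hr : 0 < r) :
    ¬ IntegrableOn (fun x => hh x ^ r / hh (r * x)) (Ioi (0 : ℝ)) := by
  intro hI
  set I := ∫ x in Ioi (0:ℝ), hh x ^ r / hh (r * x) with hIdef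
  have key : ∀ k : ℕ, Real.exp (((k:ℝ)+1 - r) * cc k) / (r * KK) ≤ I := by
    intro k
    have hck := cc_ge k
    have hk : (0:ℝ) ≤ k := Nat.cast_nonneg k
    have hak : 0 < aa k := by
      unfold aa
      have : 0 < cc k := by linarith
      positivity
    have hsub : Icc (aa k / r) (bb k / r) ⊆ Ioi 0 := fun x hx =>
      lt_of_lt_of_le (by positivity) hx.1
    have h1 := setIntegral_ge_of_const_le_real (μ := volume) (s := Icc (aa k / r) (bb k / r))
      (f := fun x => hh x ^ r / hh (r * x)) (c := Real.exp (-(r * cc k)) / KK)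
      measurableSet_Icc (by simp) (fun x hx => by
        refine hh_ratio r hr k (hsub hx) ?_ ?_
        · have := (div_le_iff₀ hr).1 hx.1; linarith
        · have := (le_div_iff₀ hr).1 hx.2; linarith) (hI.mono_set hsub)
    have h2 : ∫ x in Icc (aa k / r) (bb k / r), hh x ^ r / hh (r * x) ≤ I := by
      refine setIntegral_mono_set hI ?_ hsub.eventuallyLE
      filter_upwards [ae_restrict_mem measurableSet_Ioi] with x hx
      have hx' : 0 < x := hx
      have := hh_pos hx'.le
      have := hh_pos (x := r * x) (by positivity)
      simp only [Pi.zero_apply]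
      positivity
    refine le_trans (le_of_eq ?_) (h1.trans h2)
    have hab : bb k / r - aa k / r = Real.exp (((k:ℝ)+1) * cc k) / r := by
      unfold aa bb; ring
    rw [Real.volume_real_Icc, hab, max_eq_left (by positivity), sub_mul, sub_eq_add_neg,
      Real.exp_add]
    have := KK_pos
    field_simp
  have hK := KK_pos
  obtain ⟨k, hk⟩ := exists_nat_gt (max r (I * (r * KK) + r))
  have hkr : r < k := lt_of_le_of_lt (le_max_left _ _) hk
  have hkI : I * (r * KK) + r < k := lt_of_le_of_lt (le_max_right _ _) hk
  have h := key k
  rw [div_le_iff₀ (by positivity)] at h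
  have h1 := Real.add_one_le_exp (((k:ℝ)+1 - r) * cc k)
  have hck := cc_ge k
  have : ((k:ℝ)+1 - r) * 1 ≤ ((k:ℝ)+1 - r) * cc k := by
    apply mul_le_mul_of_nonneg_left <;> linarith
  linarith

/-- Theorem 1.2: there is a log convex, integrable function `h : (0,∞) → (0,∞)` with
`h(n)^(1/n) → 1`, such that `x ↦ h(x)^r / h(r*x)` is not integrable on `(0,∞)`
for any `r > 0`. -/
theorem exists_logConvex_integrable_pow_div_not_integrable :
    ∃ h : ℝ → ℝ,
      (∀ x ∈ Ioi (0 : ℝ), 0 < h x) ∧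
      ConvexOn ℝ (Ioi (0 : ℝ)) (fun x => Real.log (h x)) ∧
      IntegrableOn h (Ioi (0 : ℝ)) ∧
      Tendsto (fun n : ℕ => h n ^ ((n : ℝ)⁻¹)) atTop (nhds 1) ∧
      ∀ r : ℝ, 0 < r →
        ¬ IntegrableOn (fun x => h x ^ r / h (r * x)) (Ioi (0 : ℝ)) :=
  ⟨hh, fun _ hx => hh_pos (le_of_lt hx), hh_convex, hh_int, hh_lim, hh_nonint⟩
end

section
/- There exists a function h : (0,∞) → (0,∞) such that h is log convex on (0,∞), h is integrable on (0,∞), lim_{n→∞} h(n)^{1/n} = 1 (limit over positive integers n), and yet the function x ↦ h(x)² / h(2x) is NOT integrable on (0,∞). In other words, the answer to Handelman's Question 1.1 is negative. -/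
open MeasureTheory Set Filter Real

noncomputable def hB (k : ℕ) : ℝ := 2 ^ k * Real.exp (-4 ^ k)

noncomputable def hT (k : ℕ) (x : ℝ) : ℝ := Real.exp (-4 ^ k - hB k * x)

noncomputable def hH (x : ℝ) : ℝ := ∑' k, hT k x

lemma hB_pos (k : ℕ) : 0 < hB k := by unfold hB; positivity

lemma hT_pos (k : ℕ) (x : ℝ) : 0 < hT k x := Real.exp_pos _

lemma nat_le_four_pow (k : ℕ) : (k : ℝ) ≤ 4 ^ k := by
  exact_mod_cast (Nat.lt_pow_self (n := k) (a := 4) (by norm_num)).le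

lemma summable_d : Summable (fun k : ℕ => Real.exp (-4 ^ k / 4)) := by
  refine Summable.of_nonneg_of_le (fun k => (Real.exp_pos _).le) (fun k => ?_)
    (Real.summable_exp_nat_mul_iff.2 (show (-(1/4) : ℝ) < 0 by norm_num))
  apply Real.exp_le_exp.2
  have := nat_le_four_pow k
  linarith

lemma summable_c : Summable (fun k : ℕ => Real.exp (-4 ^ k)) := by
  refine Summable.of_nonneg_of_le (fun k => (Real.exp_pos _).le) (fun k => ?_) summable_d
  apply Real.exp_le_exp.2
  have : (0:ℝ) < 4 ^ k := by positivity
  linarith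

lemma hT_le (k : ℕ) {x : ℝ} (hx : 0 ≤ x) : hT k x ≤ Real.exp (-4 ^ k) := by
  apply Real.exp_le_exp.2
  have := mul_nonneg (hB_pos k).le hx
  linarith

lemma summable_T {x : ℝ} (hx : 0 ≤ x) : Summable (fun k => hT k x) :=
  Summable.of_nonneg_of_le (fun k => (hT_pos k x).le) (fun k => hT_le k hx) summable_c

lemma hT_le_hH (k : ℕ) {x : ℝ} (hx : 0 ≤ x) : hT k x ≤ hH x :=
  (summable_T hx).le_tsum k (fun j _ => (hT_pos j x).le)

lemma hH_pos {x : ℝ} (hx : 0 ≤ x) : 0 < hH x := (hT_pos 0 x).trans_le (hT_le_hH 0 hx)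

lemma hH_convex : ConvexOn ℝ (Ioi (0 : ℝ)) (fun x => Real.log (hH x)) := by
  rw [convexOn_iff_forall_pos]
  refine ⟨convex_Ioi 0, ?_⟩
  intro x hx y hy a b ha hb hab
  have hx' : 0 ≤ x := le_of_lt hx
  have hy' : 0 ≤ y := le_of_lt hy
  have h1 : ∀ k, hT k (a • x + b • y) = hT k x ^ a * hT k y ^ b := by
    intro k
    simp only [hT, smul_eq_mul]
    rw [← Real.exp_mul, ← Real.exp_mul, ← Real.exp_add]
    congr 1
    have : b = 1 - a := by linarith
    subst this
    ring
  have h2 : ∀ (c : ℝ), 0 < c → ∀ z k, (hT k z ^ c) ^ (1 / c) = hT k z := by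
    intro c hc z k
    rw [← Real.rpow_mul (hT_pos k z).le, mul_one_div_cancel hc.ne', Real.rpow_one]
  have key := Real.inner_le_Lp_mul_Lq_tsum_of_nonneg (f := fun k => hT k x ^ a)
    (g := fun k => hT k y ^ b) (Real.holderConjugate_one_div ha hb hab)
    (fun k => by have := hT_pos k x; positivity) (fun k => by have := hT_pos k y; positivity)
    (by simpa only [h2 a ha] using summable_T hx')
    (by simpa only [h2 b hb] using summable_T hy')
  simp only [h2 a ha, h2 b hb, one_div_one_div] at key
  have h3 : hH (a • x + b • y) ≤ hH x ^ a * hH y ^ b := by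
    simpa only [hH, h1] using key
  have px := hH_pos hx'
  have py := hH_pos hy'
  have pz : 0 < hH (a • x + b • y) := hH_pos (by simp only [smul_eq_mul]; positivity)
  have := Real.log_le_log pz h3
  rw [Real.log_mul (by positivity) (by positivity), Real.log_rpow px, Real.log_rpow py] at this
  simpa using this

lemma hT_eq (k : ℕ) : hT k = fun x => Real.exp (-4 ^ k) * Real.exp (-hB k * x) := by
  funext x
  rw [hT, ← Real.exp_add]
  congr 1
  ring

lemma hT_int (k : ℕ) : IntegrableOn (hT k) (Ioi 0) := by
  rw [hT_eq]
  exact (integrableOn_exp_mul_Ioi (neg_lt_zero.2 (hB_pos k)) 0).const_mul _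

lemma hT_integral (k : ℕ) : ∫ x in Ioi 0, hT k x = (1 / 2) ^ k := by
  rw [hT_eq, integral_const_mul, integral_exp_mul_Ioi (neg_lt_zero.2 (hB_pos k)) 0]
  have := Real.exp_pos (-4 ^ k)
  simp only [hB, mul_zero, Real.exp_zero]
  field_simp
  rw [← mul_pow]; norm_num

lemma hH_int : IntegrableOn hH (Ioi 0) := by
  have h := hasSum_integral_of_summable_integral_norm (F := hT) (μ := volume.restrict (Ioi 0))
    hT_int (by
      have : ∀ k x, ‖hT k x‖ = hT k x := fun k x => Real.norm_of_nonneg (hT_pos k x).le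
      simp only [this, hT_integral]
      exact summable_geometric_of_lt_one (by norm_num) (by norm_num))
  simp only [hT_integral] at h
  have h2 := h.unique (hasSum_geometric_of_lt_one (by norm_num) (by norm_num))
  by_contra hn
  have := integral_undef hn
  simp only [hH] at this
  rw [this] at h2
  norm_num at h2

lemma hB_tendsto : Tendsto hB atTop (nhds 0) := by
  have h1 : Tendsto (fun k : ℕ => (1 / 2 : ℝ) ^ k) atTop (nhds 0) :=
    tendsto_pow_atTop_nhds_zero_of_lt_one (by norm_num) (by norm_num)
  refine squeeze_zero (fun k => (hB_pos k).le) (fun k => ?_) h1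
  have h4 : (4:ℝ) ^ k ≤ Real.exp (4 ^ k) := by
    have := Real.add_one_le_exp ((4:ℝ) ^ k); linarith
  have h5 : (4:ℝ) ^ k = 2 ^ k * 2 ^ k := by rw [← mul_pow]; norm_num
  rw [hB, Real.exp_neg, ← div_eq_mul_inv, div_le_iff₀ (Real.exp_pos _)]
  calc (2:ℝ) ^ k = (1 / 2) ^ k * 4 ^ k := by rw [← mul_pow]; norm_num
    _ ≤ _ := by gcongr

lemma hH_lim : Tendsto (fun n : ℕ => hH n ^ ((n : ℝ)⁻¹)) atTop (nhds 1) := by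
  have hlog : Tendsto (fun n : ℕ => Real.log (hH n) * ((n : ℝ)⁻¹)) atTop (nhds 0) := by
    have hinv : Tendsto (fun n : ℕ => ((n : ℝ)⁻¹)) atTop (nhds 0) :=
      tendsto_inv_atTop_nhds_zero_nat
    rw [tendsto_order]
    constructor
    · intro e he
      obtain ⟨k, hk⟩ := (hB_tendsto.eventually (gt_mem_nhds (show 0 < -e by linarith))).exists
      have h1 : Tendsto (fun n : ℕ => (-4 ^ k) * ((n : ℝ)⁻¹) - hB k) atTop
          (nhds ((-4 ^ k) * 0 - hB k)) := (hinv.const_mul _).sub_const _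
      filter_upwards [h1.eventually (lt_mem_nhds (show e < _ by linarith)),
        eventually_gt_atTop 0] with n hn hn0
      have hn0' : (0:ℝ) < n := by exact_mod_cast hn0
      refine hn.trans_le ?_
      have h2 := Real.log_le_log (hT_pos k n) (hT_le_hH k hn0'.le)
      rw [hT, Real.log_exp] at h2
      calc (-4 ^ k) * ((n : ℝ)⁻¹) - hB k = (-4 ^ k - hB k * n) * ((n : ℝ)⁻¹) := by field_simp
        _ ≤ _ := by gcongr
    · intro e he
      have h1 : Tendsto (fun n : ℕ => Real.log (∑' k : ℕ, Real.exp (-4 ^ k)) * ((n : ℝ)⁻¹)) atTop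
          (nhds (Real.log (∑' k : ℕ, Real.exp (-4 ^ k)) * 0)) := hinv.const_mul _
      rw [mul_zero] at h1
      filter_upwards [h1.eventually (gt_mem_nhds he)] with n hn
      refine lt_of_le_of_lt ?_ hn
      have hn0 : (0:ℝ) ≤ n := n.cast_nonneg
      have h2 : hH n ≤ ∑' k : ℕ, Real.exp (-4 ^ k) :=
        (summable_T hn0).tsum_le_tsum (fun k => hT_le k hn0) summable_c
      have := Real.log_le_log (hH_pos hn0) h2
      gcongr
  have := (Real.continuous_exp.tendsto 0).comp hlog
  rw [Real.exp_zero] at this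
  refine this.congr (fun n => ?_)
  rw [Real.rpow_def_of_pos (hH_pos n.cast_nonneg)]
  rfl

lemma term_bound (k j : ℕ) (hjk : j ≠ k) {x : ℝ} (h1 : Real.exp (4 ^ k) / 2 ≤ x)
    (h2 : x ≤ Real.exp (4 ^ k)) :
    hT j (2 * x) ≤ hT k (2 * x) * Real.exp (-4 ^ j / 4) := by
  rw [hT, hT, ← Real.exp_add]
  apply Real.exp_le_exp.2
  have hx0 : 0 < x := lt_of_lt_of_le (by positivity) h1
  have hBk : hB k * x ≤ 2 ^ k := by
    calc hB k * x ≤ hB k * Real.exp (4 ^ k) := by have := hB_pos k; gcongr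
      _ = 2 ^ k := by rw [hB, mul_assoc, ← Real.exp_add]; simp
  have h24 : (2:ℝ) ^ k ≤ 4 ^ k := pow_le_pow_left₀ (by norm_num) (by norm_num) k
  have hBj : 0 ≤ hB j * x := mul_nonneg (hB_pos j).le hx0.le
  have hj0 : (0:ℝ) < 4 ^ j := by positivity
  rcases lt_or_gt_of_ne hjk with h | h
  · obtain ⟨m, rfl⟩ : ∃ m, k = m + 1 := ⟨k - 1, by omega⟩
    have hjm : (4:ℝ) ^ j ≤ 4 ^ m := pow_le_pow_right₀ (by norm_num) (by omega)
    have hu : (1:ℝ) ≤ 4 ^ m := one_le_pow₀ (by norm_num)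
    have h2m : (2:ℝ) ^ m ≤ 4 ^ m := pow_le_pow_left₀ (by norm_num) (by norm_num) m
    rw [pow_succ] at *
    generalize (4:ℝ) ^ m = u at *
    have hE : 8 * u ≤ Real.exp (3 * u) := by
      have e1 := Real.add_one_le_exp u
      have : Real.exp (3 * u) = Real.exp u ^ 3 := by rw [← Real.exp_nat_mul]; norm_num
      rw [this]
      calc 8 * u ≤ (u + 1) ^ 3 := by nlinarith [sq_nonneg (u - 1), mul_nonneg (sq_nonneg (u-1)) (show 0 ≤ u by linarith)]
        _ ≤ _ := by gcongr
    have hB1 : Real.exp (3 * u) ≤ hB j * (2 * x) := by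
      calc Real.exp (3 * u) ≤ Real.exp (-4 ^ j + u * 4) := Real.exp_le_exp.2 (by linarith)
        _ = 1 * Real.exp (-4 ^ j) * Real.exp (u * 4) := by rw [Real.exp_add]; ring
        _ ≤ 2 ^ j * Real.exp (-4 ^ j) * (2 * x) := by
            gcongr
            · exact one_le_pow₀ (by norm_num)
            · linarith
        _ = _ := by rw [hB]
    have h3 : hB (m+1) * x ≤ 2 * u := by
      linarith
    linarith
  · have h4 : (4:ℝ) ^ (k + 1) ≤ 4 ^ j := pow_le_pow_right₀ (by norm_num) (by omega)
    rw [pow_succ] at h4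
    linarith

lemma hH_upper : ∃ E : ℝ, 0 < E ∧ ∀ k : ℕ, ∀ x, Real.exp (4 ^ k) / 2 ≤ x →
    x ≤ Real.exp (4 ^ k) → hH (2 * x) ≤ hT k (2 * x) * E := by
  refine ⟨∑' j : ℕ, Real.exp (-4 ^ j / 4) + 1, ?_, ?_⟩
  · have : 0 ≤ ∑' j : ℕ, Real.exp (-4 ^ j / 4) := tsum_nonneg (fun j => (Real.exp_pos _).le)
    linarith
  · intro k x h1 h2
    have hx0 : 0 < x := lt_of_lt_of_le (by positivity) h1
    have hs := (summable_d.hasSum.add (hasSum_ite_eq k (1:ℝ))).mul_left (hT k (2 * x))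
    refine hasSum_le (fun j => ?_) (summable_T (x := 2 * x) (by positivity)).hasSum hs
    have := hT_pos k (2 * x)
    have hd := Real.exp_pos (-4 ^ j / 4)
    by_cases hj : j = k
    · subst hj
      simp only [if_true]
      nlinarith
    · simp only [hj, if_false, add_zero]
      exact term_bound k j hj h1 h2

lemma hH_not_int : ¬ IntegrableOn (fun x => hH x ^ 2 / hH (2 * x)) (Ioi (0 : ℝ)) := by
  intro hint
  obtain ⟨E, hE, hup⟩ := hH_upper
  have hL : Tendsto (fun k : ℕ => Real.exp (4 ^ k)) atTop atTop :=
    Real.tendsto_exp_atTop.comp (tendsto_pow_atTop_atTop_of_one_lt (by norm_num))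
  have hL2 : Tendsto (fun k : ℕ => Real.exp (4 ^ k) / 2) atTop atTop :=
    hL.atTop_div_const (by norm_num)
  have t := (intervalIntegral_tendsto_integral_Ioi 0 hint hL).sub
    (intervalIntegral_tendsto_integral_Ioi 0 hint hL2)
  rw [sub_self] at t
  have hlow : ∀ k : ℕ, 1 / (2 * E) ≤ (∫ x in (0:ℝ)..Real.exp (4 ^ k), hH x ^ 2 / hH (2 * x)) -
      ∫ x in (0:ℝ)..Real.exp (4 ^ k) / 2, hH x ^ 2 / hH (2 * x) := by
    intro k
    have hp := Real.exp_pos (4 ^ k)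
    have hii : ∀ a b : ℝ, 0 ≤ a → a ≤ b →
        IntervalIntegrable (fun x => hH x ^ 2 / hH (2 * x)) volume a b := by
      intro a b ha hab
      rw [intervalIntegrable_iff_integrableOn_Ioc_of_le hab]
      exact hint.mono_set (fun x hx => lt_of_le_of_lt ha hx.1)
    rw [intervalIntegral.integral_interval_sub_left (hii _ _ le_rfl hp.le)
      (hii _ _ le_rfl (by positivity))]
    have hle : Real.exp (4 ^ k) / 2 ≤ Real.exp (4 ^ k) := by linarith
    have hm := intervalIntegral.integral_mono_on (f := fun _ => Real.exp (-4 ^ k) / E) hle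
      intervalIntegrable_const (hii _ _ (by positivity) hle) (by
        intro x hx
        have hx0 : 0 < x := lt_of_lt_of_le (by positivity) hx.1
        have hu := hup k x hx.1 hx.2
        have hl := hT_le_hH k hx0.le
        have p1 := hT_pos k x
        have p2 := hH_pos (x := 2 * x) (by positivity)
        rw [div_le_div_iff₀ hE p2]
        calc Real.exp (-4 ^ k) * hH (2 * x) ≤ Real.exp (-4 ^ k) * (hT k (2 * x) * E) := by gcongr
          _ = hT k x ^ 2 * E := by
            rw [← mul_assoc]
            congr 1
            rw [hT, hT, ← Real.exp_add, ← Real.exp_nat_mul]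
            congr 1
            push_cast
            ring
          _ ≤ _ := by gcongr)
    refine le_trans (le_of_eq ?_) hm
    rw [intervalIntegral.integral_const, smul_eq_mul, Real.exp_neg]
    field_simp
    norm_num
  have := ge_of_tendsto' t hlow
  have : 0 < 1 / (2 * E) := by positivity
  linarith

/-- Negative answer to Handelman's Question 1.1: there is a log convex, integrable
function `h : (0,∞) → (0,∞)` with `h(n)^(1/n) → 1`, such that `x ↦ h(x)^2 / h(2x)`
is not integrable on `(0,∞)`. -/
theorem exists_logConvex_integrable_sq_div_not_integrable :
    ∃ h : ℝ → ℝ,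
      (∀ x ∈ Ioi (0 : ℝ), 0 < h x) ∧
      ConvexOn ℝ (Ioi (0 : ℝ)) (fun x => Real.log (h x)) ∧
      IntegrableOn h (Ioi (0 : ℝ)) ∧
      Tendsto (fun n : ℕ => h n ^ ((n : ℝ)⁻¹)) atTop (nhds 1) ∧
      ¬ IntegrableOn (fun x => h x ^ 2 / h (2 * x)) (Ioi (0 : ℝ)) :=
  ⟨hH, fun _ hx => hH_pos (le_of_lt hx), hH_convex, hH_int, hH_lim, hH_not_int⟩
end

section
/- Suppose h : (0,∞) → (0,∞) is log convex on (0,∞), satisfies lim_{n→∞} h(n)/h(n+1) = 1 (limit over positive integers n), and the function x ↦ h(x)² / h(2x) is integrable on (0,∞). Then h is integrable on (0,∞). -/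
open MeasureTheory Set Filter Real

/-- Theorem 1.4 (Handelman's conjecture): if `h : (0,∞) → (0,∞)` is log convex,
`h(n)/h(n+1) → 1`, and `x ↦ h(x)^2 / h(2x)` is integrable on `(0,∞)`,
then `h` is integrable on `(0,∞)`. -/
theorem integrable_of_logConvex_of_ratio_tendsto_one
    (h : ℝ → ℝ)
    (hpos : ∀ x ∈ Ioi (0 : ℝ), 0 < h x)
    (hconv : ConvexOn ℝ (Ioi (0 : ℝ)) (fun x => Real.log (h x)))
    (hratio : Tendsto (fun n : ℕ => h n / h (n + 1)) atTop (nhds 1))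
    (hint : IntegrableOn (fun x => h x ^ 2 / h (2 * x)) (Ioi (0 : ℝ))) :
    IntegrableOn h (Ioi (0 : ℝ)) := by
  have hlim : Tendsto (fun n : ℕ => - Real.log (h n / h (n + 1))) atTop (nhds 0) := by
    have := (hratio.log one_ne_zero).neg
    simpa using this
  have hdec : ∀ x ∈ Ioi (0 : ℝ), h (2 * x) ≤ h x := by
    intro x hx
    have hx0 : 0 < x := hx
    have h2x : (2 * x) ∈ Ioi (0 : ℝ) := by simp only [mem_Ioi]; linarith
    have key : (Real.log (h (2 * x)) - Real.log (h x)) / (2 * x - x) ≤ 0 := by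
      refine ge_of_tendsto hlim ?_
      filter_upwards [eventually_gt_atTop ⌈2 * x⌉₊] with n hn
      have hn' : 2 * x < n := Nat.lt_of_ceil_lt hn
      have n0 : (n : ℝ) ∈ Ioi (0 : ℝ) := by simp only [mem_Ioi]; linarith
      have n1 : (n : ℝ) + 1 ∈ Ioi (0 : ℝ) := by simp only [mem_Ioi]; linarith
      have a := hconv.slope_mono_adjacent hx n0 (show x < 2 * x by linarith) hn'
      have b := hconv.slope_mono_adjacent h2x n1 hn' (show (n : ℝ) < n + 1 by linarith)
      have c := a.trans b
      rw [Real.log_div (hpos _ n0).ne' (hpos _ n1).ne']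
      simp only [add_sub_cancel_left, div_one] at c
      linarith
    have hd : Real.log (h (2 * x)) - Real.log (h x) ≤ 0 := by
      have : 2 * x - x = x := by ring
      rw [this, div_le_iff₀ hx0] at key
      linarith
    exact (Real.log_le_log_iff (hpos _ h2x) (hpos _ hx)).1 (by linarith)
  have hcont : ContinuousOn h (Ioi (0 : ℝ)) := by
    have h1 := (hconv.continuousOn isOpen_Ioi).rexp
    exact h1.congr fun x hx => (Real.exp_log (hpos x hx)).symm
  refine Integrable.mono' hint (hcont.aestronglyMeasurable measurableSet_Ioi) ?_
  filter_upwards [ae_restrict_mem measurableSet_Ioi] with x hx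
  have hx0 : 0 < x := hx
  have h2x : (2 * x) ∈ Ioi (0 : ℝ) := by simp only [mem_Ioi]; linarith
  have p := hpos x hx
  rw [Real.norm_of_nonneg p.le, le_div_iff₀ (hpos _ h2x), sq]
  exact mul_le_mul_of_nonneg_left (hdec x hx) p.le
end

section
/- Let h : (0,∞) → (0,∞) be log convex on (0,∞) and suppose lim_{n→∞} h(n)/h(n+1) = 1 (limit over positive integers n). Then h is antitone (monotone nonincreasing) on (0,∞). -/
open MeasureTheory Set Filter Real

/-- Key dichotomy step in the proof of Theorem 1.4: if `h : (0,∞) → (0,∞)` is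
log convex and `h(n)/h(n+1) → 1`, then `h` is antitone on `(0,∞)`. -/
theorem antitoneOn_of_logConvex_of_ratio_tendsto_one
    (h : ℝ → ℝ)
    (hpos : ∀ x ∈ Ioi (0 : ℝ), 0 < h x)
    (hconv : ConvexOn ℝ (Ioi (0 : ℝ)) (fun x => Real.log (h x)))
    (hratio : Tendsto (fun n : ℕ => h n / h (n + 1)) atTop (nhds 1)) :
    AntitoneOn h (Ioi (0 : ℝ)) := by
  intro x hx y hy hxy
  rcases eq_or_lt_of_le hxy with rfl | hlt
  · exact le_rfl
  have hx0 : (0 : ℝ) < x := hx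
  have hy0 : (0 : ℝ) < y := hy
  have hlog : Tendsto (fun n : ℕ => -Real.log (h n / h (n + 1))) atTop (nhds 0) := by
    have := (hratio.log one_ne_zero).neg
    simpa using this
  have hslope : (Real.log (h y) - Real.log (h x)) / (y - x) ≤ 0 := by
    refine ge_of_tendsto hlog ?_
    filter_upwards [tendsto_natCast_atTop_atTop.eventually (eventually_gt_atTop y)] with n hn
    have hn0 : (0 : ℝ) < n := hy0.trans hn
    have hn1 : (0 : ℝ) < (n : ℝ) + 1 := by linarith
    have h1 := hconv.slope_mono_adjacent hx (mem_Ioi.2 hn0) hlt hn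
    have h2 := hconv.slope_mono_adjacent hy (mem_Ioi.2 hn1) hn (lt_add_one (n : ℝ))
    have h3 : Real.log (h n / h (n + 1)) = Real.log (h n) - Real.log (h (n + 1)) :=
      Real.log_div (hpos _ hn0).ne' (hpos _ hn1).ne'
    have h4 : (n : ℝ) + 1 - n = 1 := by ring
    rw [h4, div_one] at h2
    have h5 := h1.trans h2
    rw [h3]
    linarith
  have hd : 0 < y - x := sub_pos.2 hlt
  rw [div_le_iff₀ hd, zero_mul] at hslope
  exact (Real.log_le_log_iff (hpos y hy) (hpos x hx)).1 (by linarith)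
end

section
/- The function h : (0,∞) → (0,∞) defined by h(x) = x^x is log convex on (0,∞) and satisfies h(x)²/h(2x) = 4^{−x} for every x > 0, so that x ↦ h(x)²/h(2x) is integrable on (0,∞); nevertheless h itself is not integrable on (0,∞). Hence the hypothesis lim_{n→∞} h(n)/h(n+1) = 1 cannot be dropped from Theorem 1.4. -/
open MeasureTheory Set Filter Real

/-- The function `h(x) = x^x` is log convex on `(0,∞)`, satisfies
`h(x)^2 / h(2x) = 4^(-x)` for `x > 0` (hence `x ↦ h(x)^2/h(2x)` is integrable
on `(0,∞)`), yet `h` itself is not integrable on `(0,∞)`.  Thus the hypothesis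
`h(n)/h(n+1) → 1` cannot be dropped from Theorem 1.4. -/
theorem rpow_self_counterexample :
    ConvexOn ℝ (Ioi (0 : ℝ)) (fun x : ℝ => Real.log (x ^ x)) ∧
    (∀ x ∈ Ioi (0 : ℝ), (x ^ x) ^ 2 / ((2 * x) ^ (2 * x)) = (4 : ℝ) ^ (-x)) ∧
    IntegrableOn (fun x : ℝ => (x ^ x) ^ 2 / ((2 * x) ^ (2 * x))) (Ioi (0 : ℝ)) ∧
    ¬ IntegrableOn (fun x : ℝ => x ^ x) (Ioi (0 : ℝ)) := by
  have key : ∀ x ∈ Ioi (0 : ℝ), (x ^ x) ^ 2 / ((2 * x) ^ (2 * x)) = (4 : ℝ) ^ (-x) := by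
    intro x hx
    have hx0 : (0 : ℝ) < x := hx
    have h1 : (2 * x) ^ (2 * x) = (4 : ℝ) ^ x * (x ^ x) ^ 2 := by
      rw [Real.mul_rpow (by norm_num) hx0.le, Real.rpow_mul (by norm_num : (0:ℝ) ≤ 2),
        mul_comm 2 x, Real.rpow_mul hx0.le]
      norm_num
    have h2 : 0 < x ^ x := Real.rpow_pos_of_pos hx0 x
    have h3 : (0:ℝ) < (4 : ℝ) ^ x := Real.rpow_pos_of_pos (by norm_num) x
    rw [h1, Real.rpow_neg (by norm_num)]
    field_simp
  refine ⟨?_, key, ?_, ?_⟩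
  · have h := Real.convexOn_mul_log.subset Ioi_subset_Ici_self (convex_Ioi (0:ℝ))
    refine h.congr ?_
    intro x hx
    exact (Real.log_rpow hx x).symm
  · have h : IntegrableOn (fun x : ℝ => Real.exp (-Real.log 4 * x)) (Ioi (0:ℝ)) :=
      exp_neg_integrableOn_Ioi 0 (Real.log_pos (by norm_num))
    refine h.congr_fun ?_ measurableSet_Ioi
    intro x hx
    simp only
    rw [key x hx, Real.rpow_def_of_pos (by norm_num)]
    congr 1
    ring
  · intro h
    have h1 : IntegrableOn (fun x : ℝ => x ^ x) (Ioi (1:ℝ)) :=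
      h.mono_set (Ioi_subset_Ioi zero_le_one)
    have h2 : IntegrableOn (fun _ : ℝ => (1:ℝ)) (Ioi (1:ℝ)) := by
      refine Integrable.mono' h1 aestronglyMeasurable_const ?_
      filter_upwards [ae_restrict_mem measurableSet_Ioi] with x hx
      have hx1 : (1:ℝ) < x := hx
      rw [norm_one]
      exact Real.one_le_rpow hx1.le (by linarith)
    rw [integrableOn_const_iff] at h2
    simp at h2
end
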